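/- Let F(x,y,z,t) = t(t−1)·x(x−y)(y+z) + (t−1)(x−y−z)yz + t(x−y)xz ∈ ℚ[x,y,z,t]. For a point (x,y,z,t) ∈ ℂ⁴ with (x,y,z) ≠ (0,0,0), all four partial derivatives ∂F/∂x, ∂F/∂y, ∂F/∂z, ∂F/∂t vanish at (x,y,z,t) if and only if either t = 0 and (x,y,z) is a nonzero scalar multiple of one of (1,0,1), (1,1,0), (1,0,0), or t = 1 and (x,y,z) is a nonzero scalar multiple of one of (0,0,1), (0,1,0), (1,1,0). -/

import Mathlib

open MvPolynomial

/-- The polynomial `F(x,y,z,t) = t(t−1)·x(x−y)(y+z) + (t−1)(x−y−z)yz + t(x−y)xz` in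
`ℚ[x,y,z,t]`, a model of the elliptic surface `S(Γ₁(7))`; the variables `x, y, z, t`
are `X 0, X 1, X 2, X 3`. -/
noncomputable def F : MvPolynomial (Fin 4) ℚ :=
  (X 3 * (X 3 - 1)) * (X 0 * (X 0 - X 1) * (X 1 + X 2))
    + (X 3 - 1) * ((X 0 - X 1 - X 2) * X 1 * X 2)
    + X 3 * ((X 0 - X 1) * X 0 * X 2)

/-- Away from `t = 0, 1` the fibre has no point where all partial derivatives vanish and the
three products are nonzero. -/
lemma generic_case (x m u : ℂ) (hu : u ≠ 0) (ht : u + 1 ≠ 0) (hx : x ≠ 0) (hm : m ≠ 0)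
    (hB : (x - m) * ((1 - u ^ 2) * m) * (u ^ 2 * m)
      = -(u + 1) ^ 2 * (x * (x - (1 - u ^ 2) * m) * m))
    (h0 : (u + 1) * u * (2 * x - (1 - u ^ 2) * m) * m + u * ((1 - u ^ 2) * m) * (u ^ 2 * m)
      + (u + 1) * (2 * x - (1 - u ^ 2) * m) * (u ^ 2 * m) = 0)
    (h2 : (u + 1) * u * (x * (x - (1 - u ^ 2) * m))
      + u * ((x - (1 - u ^ 2) * m - 2 * (u ^ 2 * m)) * ((1 - u ^ 2) * m))
      + (u + 1) * (x - (1 - u ^ 2) * m) * x = 0) : False := by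
  have e1 : 2 * x * (1 + u) = (1 + u - 2 * u ^ 2) * m := by
    have : (u * (u + 1) * m) * (2 * x * (1 + u) - (1 + u - 2 * u ^ 2) * m) = 0 := by
      linear_combination h0
    have := (mul_eq_zero.mp this).resolve_left (by simp [hu, ht, hm])
    linear_combination this
  have e2 : (x - m) * (1 - u) * u ^ 2 * m + (1 + u) * x * (x - (1 - u ^ 2) * m) = 0 := by
    have : ((u + 1) * m) * ((x - m) * (1 - u) * u ^ 2 * m
        + (1 + u) * x * (x - (1 - u ^ 2) * m)) = 0 := by
      linear_combination hB
    exact (mul_eq_zero.mp this).resolve_left (by simp [ht, hm])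
  have e3 : (1 - u) * ((1 - u) * x - (1 - u + u ^ 2) * m) = 0 := by
    have : ((u + 1) * u * m) * ((1 - u) * ((1 - u) * x - (1 - u + u ^ 2) * m)) = 0 := by
      linear_combination h2 - (u + 1) * e2
    exact (mul_eq_zero.mp this).resolve_left (by simp [hu, ht, hm])
  rcases mul_eq_zero.mp e3 with h | h
  · have hu1 : u = 1 := by linear_combination -h
    subst hu1
    apply hx
    linear_combination e1 / 4
  · have q1 : 3 * u ^ 2 + 1 = 0 := by
      have : m * (3 * u ^ 2 + 1) = 0 := by
        linear_combination (1 - u) * e1 - 2 * (1 + u) * h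
      exact (mul_eq_zero.mp this).resolve_left hm
    have q2 : (1 - u) * (4 * u ^ 2 + 3 * u + 1) = 0 := by
      have : m ^ 2 * ((1 - u) * (4 * u ^ 2 + 3 * u + 1)) = 0 := by
        linear_combination -4 * (1 + u) * e2
          + (2 * x * (1 + u) - (1 + u - 2 * u ^ 2) * m) * e1
      exact (mul_eq_zero.mp this).resolve_left (by simp [hm])
    grind

lemma forward (x y z t : ℂ) (hv : ¬(x = 0 ∧ y = 0 ∧ z = 0))
    (h0 : t * (t - 1) * ((2 * x - y) * (y + z)) + (t - 1) * (y * z) + t * ((2 * x - y) * z) = 0)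
    (h1 : t * (t - 1) * (x * (x - 2 * y - z)) + (t - 1) * ((x - 2 * y - z) * z)
      - t * (x * z) = 0)
    (h2 : t * (t - 1) * (x * (x - y)) + (t - 1) * ((x - y - 2 * z) * y) + t * ((x - y) * x) = 0)
    (h3 : (2 * t - 1) * (x * (x - y) * (y + z)) + (x - y - z) * y * z + (x - y) * x * z = 0) :
    (t = 0 ∧ ((y = 0 ∧ z = x) ∨ (y = x ∧ z = 0) ∨ (y = 0 ∧ z = 0))) ∨
    (t = 1 ∧ ((x = 0 ∧ y = 0) ∨ (x = 0 ∧ z = 0) ∨ (y = x ∧ z = 0))) := by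
  by_cases ht0 : t = 0
  · subst ht0
    left
    grind
  by_cases ht1 : t = 1
  · subst ht1
    right
    grind
  exfalso
  have ht1' : t - 1 ≠ 0 := sub_ne_zero.mpr ht1
  have hF : t * (t - 1) * (x * (x - y) * (y + z)) + (t - 1) * ((x - y - z) * y * z)
      + t * ((x - y) * x * z) = 0 := by
    linear_combination (x * h0 + y * h1 + z * h2) / 3
  have hB : (x - y - z) * y * z = -t ^ 2 * (x * (x - y) * (y + z)) := by
    linear_combination t * h3 - hF
  have hC : (x - y) * x * z = (t - 1) ^ 2 * (x * (x - y) * (y + z)) := by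
    linear_combination h3 - hB
  by_cases hx : x = 0
  · subst hx
    grind
  by_cases hxy : x - y = 0
  · have : y = x := by linear_combination -hxy
    subst this
    grind
  have hz : z = (t - 1) ^ 2 * (y + z) := by
    have : (x * (x - y)) * (z - (t - 1) ^ 2 * (y + z)) = 0 := by linear_combination hC
    have := (mul_eq_zero.mp this).resolve_left (by simp [hx, hxy])
    linear_combination this
  obtain ⟨m, hm⟩ : ∃ m, m = y + z := ⟨_, rfl⟩
  obtain ⟨u, hu⟩ : ∃ u, u = t - 1 := ⟨_, rfl⟩
  have ht : t = u + 1 := by rw [hu]; ring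
  rw [← hm, ← hu] at hz
  have hy : y = (1 - u ^ 2) * m := by linear_combination -hm - hz
  by_cases hm0 : m = 0
  · subst hm0
    grind
  subst ht hz
  rw [hy] at *
  refine generic_case x m u ?_ ht0 hx hm0 ?_ ?_ ?_
  · simpa using ht1'
  · linear_combination hB
  · linear_combination h0
  · linear_combination h2

/-- For a point `(x,y,z,t) ∈ ℂ⁴` with `(x,y,z) ≠ (0,0,0)`, all four partial derivatives of
`F` vanish at `(x,y,z,t)` if and only if either `t = 0` and `(x,y,z)` is a nonzero scalar
multiple of one of `(1,0,1)`, `(1,1,0)`, `(1,0,0)`, or `t = 1` and `(x,y,z)` is a nonzero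
scalar multiple of one of `(0,0,1)`, `(0,1,0)`, `(1,1,0)`. -/
theorem singular_points_of_F (v : Fin 4 → ℂ) (hv : ¬(v 0 = 0 ∧ v 1 = 0 ∧ v 2 = 0)) :
    (∀ i : Fin 4, aeval v (pderiv i F) = 0)
    ↔
    ((v 3 = 0 ∧ ∃ c : ℂ, c ≠ 0 ∧
        ((v 0 = c ∧ v 1 = 0 ∧ v 2 = c) ∨
         (v 0 = c ∧ v 1 = c ∧ v 2 = 0) ∨
         (v 0 = c ∧ v 1 = 0 ∧ v 2 = 0))) ∨
     (v 3 = 1 ∧ ∃ c : ℂ, c ≠ 0 ∧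
        ((v 0 = 0 ∧ v 1 = 0 ∧ v 2 = c) ∨
         (v 0 = 0 ∧ v 1 = c ∧ v 2 = 0) ∨
         (v 0 = c ∧ v 1 = c ∧ v 2 = 0)))) := by
  have key : (∀ i : Fin 4, aeval v (pderiv i F) = 0) ↔
      (v 3 * (v 3 - 1) * ((2 * v 0 - v 1) * (v 1 + v 2)) + (v 3 - 1) * (v 1 * v 2)
        + v 3 * ((2 * v 0 - v 1) * v 2) = 0 ∧
      v 3 * (v 3 - 1) * (v 0 * (v 0 - 2 * v 1 - v 2))
        + (v 3 - 1) * ((v 0 - 2 * v 1 - v 2) * v 2) - v 3 * (v 0 * v 2) = 0 ∧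
      v 3 * (v 3 - 1) * (v 0 * (v 0 - v 1)) + (v 3 - 1) * ((v 0 - v 1 - 2 * v 2) * v 1)
        + v 3 * ((v 0 - v 1) * v 0) = 0 ∧
      (2 * v 3 - 1) * (v 0 * (v 0 - v 1) * (v 1 + v 2)) + (v 0 - v 1 - v 2) * v 1 * v 2
        + (v 0 - v 1) * v 0 * v 2 = 0) := by
    simp only [Fin.forall_fin_succ, IsEmpty.forall_iff, and_true, F]
    refine and_congr ?_ (and_congr ?_ (and_congr ?_ ?_)) <;>
    · simp [pderiv_X, Pi.single_apply, Derivation.leibniz]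
      ring_nf
  rw [key]
  constructor
  · rintro ⟨h0, h1, h2, h3⟩
    have := forward _ _ _ _ hv h0 h1 h2 h3
    rcases this with ⟨ht, h⟩ | ⟨ht, h⟩
    · refine Or.inl ⟨ht, v 0, ?_, ?_⟩ <;> grind
    · refine Or.inr ⟨ht, ?_⟩
      rcases h with h | h | h
      · exact ⟨v 2, by grind, by grind⟩
      · exact ⟨v 1, by grind, by grind⟩
      · exact ⟨v 0, by grind, by grind⟩
  · rintro (⟨ht, c, hc, h⟩ | ⟨ht, c, hc, h⟩) <;> rcases h with ⟨a, b, d⟩ | ⟨a, b, d⟩ | ⟨a, b, d⟩ <;>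
      rw [ht, a, b, d] <;> refine ⟨?_, ?_, ?_, ?_⟩ <;> ring
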